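/- For every complex number q with |q| < 1, Σ_{n=1}^∞ ε₈₄(n) · q^{(n²−1)/168} = Σ_{n=0}^∞ (−1)^n q^{n(n+1)/2} / ∏_{k=1}^{n} (1 − q^{n+k}), where ε₈₄(n) = 1 if n ≡ 1, 41, 55 or 71 (mod 84), ε₈₄(n) = −1 if n ≡ 13, 29, 43 or 83 (mod 84), and ε₈₄(n) = 0 otherwise; note that (n² − 1)/168 is a nonnegative integer whenever ε₈₄(n) ≠ 0, and both series converge absolutely. -/

import Mathlib

/-- `ε₈₄(n)`: `+1` if `n ≡ 1, 41, 55, 71 (mod 84)`,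
`−1` if `n ≡ 13, 29, 43, 83 (mod 84)`, else `0`. -/
def eps84 (n : ℕ) : ℤ :=
  if n % 84 = 1 ∨ n % 84 = 41 ∨ n % 84 = 55 ∨ n % 84 = 71 then 1
  else if n % 84 = 13 ∨ n % 84 = 29 ∨ n % 84 = 43 ∨ n % 84 = 83 then -1 else 0

open Finset Filter Topology

/-- The `q`-Pochhammer symbol `(q; q)_n`. -/
noncomputable def qPoch (q : ℂ) (n : ℕ) : ℂ := ∏ k ∈ range n, (1 - q ^ (k + 1))

/-- The reciprocal `1 / (q; q)_n`, extended by zero to negative `n`. -/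
noncomputable def qPochInv (q : ℂ) (n : ℤ) : ℂ := if n < 0 then 0 else (qPoch q n.toNat)⁻¹

/-- The summand factor `(-1)^n q^{n(n+1)/2}`. -/
noncomputable def triSign (q : ℂ) (n : ℕ) : ℂ := (-1) ^ n * q ^ (n * (n + 1) / 2)

/-- The coefficient `q^{6j²-j} (1 - q^{6j+1})` of the Bailey pair with `β_n = 1 / (q; q)_{2n}`. -/
noncomputable def baileyCoeff (q : ℂ) (j : ℤ) : ℂ := q ^ (6 * j ^ 2 - j) * (1 - q ^ (6 * j + 1))

/-- The kernel of the conjugate Bailey pair. -/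
noncomputable def baileyKernel (q : ℂ) (n : ℕ) (r : ℤ) : ℂ :=
  qPoch q n * triSign q n * qPochInv q (n - r) * qPochInv q (n + r + 1)

section

variable {q : ℂ}

lemma one_sub_pow_ne_zero (hq : ‖q‖ < 1) (n : ℕ) : 1 - q ^ (n + 1) ≠ 0 := by
  intro h
  have h1 : ‖q ^ (n + 1)‖ < 1 := by
    rw [norm_pow]
    exact pow_lt_one₀ (norm_nonneg _) hq (by simp)
  rw [← sub_eq_zero.mp h, norm_one] at h1
  exact lt_irrefl _ h1

lemma qPoch_ne_zero (hq : ‖q‖ < 1) (n : ℕ) : qPoch q n ≠ 0 :=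
  prod_ne_zero_iff.mpr fun k _ => one_sub_pow_ne_zero hq k

lemma qPoch_succ (n : ℕ) : qPoch q (n + 1) = qPoch q n * (1 - q ^ (n + 1)) :=
  prod_range_succ _ _

lemma qPochInv_natCast (n : ℕ) : qPochInv q n = (qPoch q n)⁻¹ := by
  simp [qPochInv]

lemma qPochInv_of_neg {n : ℤ} (hn : n < 0) : qPochInv q n = 0 := if_pos hn

lemma one_sub_zpow_mul_qPochInv (hq : ‖q‖ < 1) (n : ℤ) :
    qPochInv q (n - 1) = (1 - q ^ n) * qPochInv q n := by
  rcases lt_trichotomy n 0 with h | rfl | h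
  · rw [qPochInv_of_neg h, qPochInv_of_neg (by lia), mul_zero]
  · rw [qPochInv_of_neg (by lia), zpow_zero, sub_self, zero_mul]
  · obtain ⟨m, rfl⟩ : ∃ m : ℕ, n = (m + 1 : ℕ) := ⟨(n - 1).toNat, by lia⟩
    rw [qPochInv_natCast, show ((m + 1 : ℕ) : ℤ) - 1 = (m : ℕ) by lia, qPochInv_natCast,
      qPoch_succ, zpow_natCast]
    have h1 := one_sub_pow_ne_zero hq m
    have h2 := qPoch_ne_zero hq m
    field_simp

lemma triSign_succ (n : ℕ) : triSign q (n + 1) = -(triSign q n * q ^ (n + 1)) := by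
  have h : (n + 1) * (n + 1 + 1) / 2 = n * (n + 1) / 2 + (n + 1) := by
    rw [← Nat.add_mul_div_right _ _ two_pos]
    congr 1
    ring
  rw [triSign, triSign, h]
  ring

lemma sum_range_telescope_int (f g : ℤ → ℂ) (h : ∀ j, f j = g (j + 1) - g j) (M : ℕ) :
    ∑ i ∈ range M, (f i + f (-1 - i)) = g M - g (-M) := by
  induction M with
  | zero => simp
  | succ M ih =>
    rw [sum_range_succ, ih, h, h, show (-1 - (M : ℤ) + 1) = -M by ring]
    push_cast
    rw [show -((M : ℤ) + 1) = -1 - M by ring]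
    ring

/-- The certificate for the first-order recurrence in `n` of the Bailey pair sum. -/
lemma baileyPair_recurrence (hq : ‖q‖ < 1) (q0 : q ≠ 0) (n : ℕ) (j : ℤ) :
    (1 - q ^ (2 * n + 1)) * (1 - q ^ (2 * n + 2)) *
        (baileyCoeff q j * qPochInv q ((n + 1 : ℕ) - 3 * j) *
          qPochInv q ((n + 1 : ℕ) + 3 * j + 1)) -
      baileyCoeff q j * qPochInv q (n - 3 * j) * qPochInv q (n + 3 * j + 1) =
    -(q ^ (6 * (j + 1) ^ 2 - (j + 1)) * q ^ (n + 1 - 3 * (j + 1)) *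
        qPochInv q (n + 1 - 3 * (j + 1)) * qPochInv q (n + 3 * (j + 1) - 1)) -
    -(q ^ (6 * j ^ 2 - j) * q ^ (n + 1 - 3 * j) *
        qPochInv q (n + 1 - 3 * j) * qPochInv q (n + 3 * j - 1)) := by
  have key := one_sub_zpow_mul_qPochInv hq
  have a1 : qPochInv q (n - 3 * j) =
      (1 - q ^ ((n : ℤ) + 1 - 3 * j)) * qPochInv q (n + 1 - 3 * j) := by
    rw [← key]; congr 1; ring
  have a2 : qPochInv q (n - 1 - 3 * j) = (1 - q ^ ((n : ℤ) - 3 * j)) * qPochInv q (n - 3 * j) := by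
    rw [← key]; congr 1; ring
  have a3 : qPochInv q (n + 1 - 3 * (j + 1)) =
      (1 - q ^ ((n : ℤ) - 1 - 3 * j)) * qPochInv q (n - 1 - 3 * j) := by
    rw [← key]; congr 1; ring
  have b1 : qPochInv q (n + 3 * j + 1) =
      (1 - q ^ ((n : ℤ) + 3 * j + 2)) * qPochInv q (n + 3 * j + 2) := by
    rw [← key]; congr 1; ring
  have b2 : qPochInv q (n + 3 * j) =
      (1 - q ^ ((n : ℤ) + 3 * j + 1)) * qPochInv q (n + 3 * j + 1) := by
    rw [← key]; congr 1; ring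
  have b3 : qPochInv q (n + 3 * j - 1) = (1 - q ^ ((n : ℤ) + 3 * j)) * qPochInv q (n + 3 * j) := by
    rw [← key]
  rw [a3, a2, a1, b3, b2, b1,
    show (((n + 1 : ℕ) : ℤ) - 3 * j) = n + 1 - 3 * j by push_cast; ring,
    show (((n + 1 : ℕ) : ℤ) + 3 * j + 1) = n + 3 * j + 2 by push_cast; ring,
    show ((n : ℤ) + 3 * (j + 1) - 1) = n + 3 * j + 2 by ring, baileyCoeff]
  generalize qPochInv q (n + 1 - 3 * j) = a
  generalize qPochInv q (n + 3 * j + 2) = b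
  have hx : q ^ (3 * j) ≠ 0 := zpow_ne_zero _ q0
  have hw : q ^ (6 * (j + 1) ^ 2 - (j + 1)) =
      q ^ (6 * j ^ 2 - j) * q ^ (3 * j) * q ^ (3 * j) * q ^ (3 * j) * q ^ (3 * j) * q ^ 5 := by
    rw [← zpow_natCast q 5]
    simp only [← zpow_add₀ q0]
    congr 1
    push_cast
    ring
  have hc : q ^ (6 * j + 1) = q ^ (3 * j) * q ^ (3 * j) * q := by
    rw [← zpow_add₀ q0, ← zpow_add_one₀ q0]
    congr 1
    ring
  rw [hw, hc, show (n : ℤ) + 1 - 3 * (j + 1) = n - 2 - 3 * j by ring]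
  simp only [zpow_add₀ q0, zpow_sub₀ q0 _ (3 * j), zpow_sub₀ q0 (n : ℤ), zpow_natCast,
    zpow_ofNat]
  generalize q ^ (6 * j ^ 2 - j) = w
  generalize q ^ (3 * j) = x at hx ⊢
  field_simp
  ring

lemma sum_baileyPair (hq : ‖q‖ < 1) (q0 : q ≠ 0) {n M : ℕ} (hn : n < M) :
    ∑ i ∈ range M,
      (baileyCoeff q i * qPochInv q (n - 3 * i) * qPochInv q (n + 3 * i + 1) +
        baileyCoeff q (-1 - i) * qPochInv q (n - 3 * (-1 - i)) *
          qPochInv q (n + 3 * (-1 - i) + 1)) = qPochInv q (2 * n : ℕ) := by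
  induction n with
  | zero =>
    rw [sum_eq_single_of_mem 0 (by simpa using hn)]
    · have h := one_sub_pow_ne_zero hq 0
      simp [baileyCoeff, qPochInv, qPoch] at h ⊢
      exact mul_inv_cancel₀ h
    · intro i _ hi
      rw [qPochInv_of_neg (n := ((0 : ℕ) : ℤ) - 3 * i) (by lia),
        qPochInv_of_neg (n := ((0 : ℕ) : ℤ) + 3 * (-1 - i) + 1) (by lia)]
      ring
  | succ n ih =>
    have h1 := one_sub_pow_ne_zero hq (2 * n)
    have h2 := one_sub_pow_ne_zero hq (2 * n + 1)
    have tel := sum_range_telescope_int _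
      (fun j => -(q ^ (6 * j ^ 2 - j) * q ^ (n + 1 - 3 * j) *
        qPochInv q (n + 1 - 3 * j) * qPochInv q (n + 3 * j - 1)))
      (baileyPair_recurrence hq q0 n) M
    rw [qPochInv_of_neg (n := (n : ℤ) + 1 - 3 * M) (by lia),
      qPochInv_of_neg (n := (n : ℤ) + 3 * (-M) - 1) (by lia)] at tel
    have e : qPochInv q (2 * n : ℕ) =
        (1 - q ^ (2 * n + 1)) * (1 - q ^ (2 * n + 2)) * qPochInv q (2 * (n + 1) : ℕ) := by
      rw [qPochInv_natCast, qPochInv_natCast, show 2 * (n + 1) = 2 * n + 1 + 1 by ring, qPoch_succ,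
        qPoch_succ]
      have := qPoch_ne_zero hq (2 * n)
      field_simp
    refine mul_left_cancel₀ (mul_ne_zero h1 h2) ?_
    rw [← e, ← ih (by lia), mul_sum, ← sub_eq_zero, ← sum_sub_distrib]
    refine Eq.trans (sum_congr rfl fun i _ => ?_) (tel.trans (by ring))
    ring

lemma baileyKernel_recurrence (hq : ‖q‖ < 1) (q0 : q ≠ 0) (n r : ℕ) :
    baileyKernel q n (r + 1 : ℕ) + q ^ (r + 1) * baileyKernel q n r =
      -((1 + q ^ (r + 1)) * (qPoch q (n + 1) * triSign q (n + 1) *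
        qPochInv q ((n + 1 : ℕ) - r - 1) * qPochInv q ((n + 1 : ℕ) + r + 1))) -
      -((1 + q ^ (r + 1)) * (qPoch q n * triSign q n *
        qPochInv q (n - r - 1) * qPochInv q (n + r + 1))) := by
  have key := one_sub_zpow_mul_qPochInv hq
  have a1 : qPochInv q (n - r - 1) = (1 - q ^ ((n : ℤ) - r)) * qPochInv q (n - r) := key _
  have b1 : qPochInv q (n + r + 1) =
      (1 - q ^ ((n : ℤ) + r + 2)) * qPochInv q (n + r + 2) := by
    rw [← key]; congr 1; ring
  rw [baileyKernel, baileyKernel, qPoch_succ, triSign_succ,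
    show (((n + 1 : ℕ) : ℤ) - r - 1) = n - r by push_cast; ring,
    show (((n + 1 : ℕ) : ℤ) + r + 1) = n + r + 2 by push_cast; ring,
    show ((n : ℤ) - (r + 1 : ℕ)) = n - r - 1 by push_cast; ring,
    show ((n : ℤ) + (r + 1 : ℕ) + 1) = n + r + 2 by push_cast; ring, a1, b1]
  have z1 : q ^ n = q ^ ((n : ℤ) - r) * q ^ r := by
    rw [← zpow_natCast, ← zpow_natCast, ← zpow_add₀ q0]; congr 1; ring
  have z2 : q ^ ((n : ℤ) + r + 2) = q ^ n * q ^ r * q ^ 2 := by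
    rw [zpow_add₀ q0, zpow_add₀ q0]; norm_cast
  rw [z2, pow_succ q n, pow_succ q r, z1]
  ring

lemma sum_baileyKernel_zero (hq : ‖q‖ < 1) (N : ℕ) :
    ∑ n ∈ range N, baileyKernel q n 0 = 1 - triSign q N * qPochInv q N := by
  induction N with
  | zero => simp [triSign, qPochInv, qPoch]
  | succ N ih =>
    rw [sum_range_succ, ih, baileyKernel, triSign_succ, sub_zero, add_zero,
      show (N : ℤ) + 1 = (N + 1 : ℕ) by push_cast; ring, qPochInv_natCast, qPochInv_natCast,
      qPoch_succ]
    have := qPoch_ne_zero hq N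
    have := one_sub_pow_ne_zero hq N
    field_simp
    ring

lemma sum_baileyKernel_succ (hq : ‖q‖ < 1) (q0 : q ≠ 0) (N r : ℕ) :
    ∑ n ∈ range N, baileyKernel q n (r + 1 : ℕ) =
      -(q ^ (r + 1) * ∑ n ∈ range N, baileyKernel q n r) -
      (1 + q ^ (r + 1)) * (qPoch q N * triSign q N *
        qPochInv q (N - r - 1) * qPochInv q (N + r + 1)) := by
  have h := sum_congr (rfl : range N = range N) fun n _ => baileyKernel_recurrence hq q0 n r
  rw [sum_range_sub (fun n : ℕ => -((1 + q ^ (r + 1)) * (qPoch q n * triSign q n *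
        qPochInv q (n - r - 1) * qPochInv q (n + r + 1)))), sum_add_distrib, ← mul_sum,
    qPochInv_of_neg (n := ((0 : ℕ) : ℤ) - r - 1) (by lia)] at h
  linear_combination h

lemma norm_prod_range_le_pow {f : ℕ → ℂ} {c : ℝ} (h : ∀ k, ‖f k‖ ≤ c) (n : ℕ) :
    ‖∏ k ∈ range n, f k‖ ≤ c ^ n := by
  rw [norm_prod]
  exact (prod_le_prod (fun _ _ => norm_nonneg _) fun k _ => h k).trans (by simp)

lemma norm_qPoch_le (hq : ‖q‖ < 1) (n : ℕ) : ‖qPoch q n‖ ≤ 2 ^ n := by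
  refine norm_prod_range_le_pow (fun k => ?_) n
  refine (norm_sub_le _ _).trans ?_
  rw [norm_one, norm_pow]
  linarith [pow_le_one₀ (norm_nonneg q) hq.le (n := k + 1)]

lemma norm_one_sub_pow_inv_le (hq : ‖q‖ < 1) (k : ℕ) :
    ‖(1 - q ^ (k + 1))⁻¹‖ ≤ (1 - ‖q‖)⁻¹ := by
  rw [norm_inv]
  refine inv_anti₀ (by linarith) ?_
  have h1 := norm_sub_norm_le (1 : ℂ) (q ^ (k + 1))
  rw [norm_one, norm_pow] at h1
  have h2 := pow_le_of_le_one (norm_nonneg q) hq.le k.add_one_ne_zero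
  linarith

lemma norm_qPochInv_le (hq : ‖q‖ < 1) (n : ℕ) : ‖qPochInv q n‖ ≤ (1 - ‖q‖)⁻¹ ^ n := by
  rw [qPochInv_natCast, qPoch, ← prod_inv_distrib]
  exact norm_prod_range_le_pow (norm_one_sub_pow_inv_le hq) n

lemma norm_triSign (n : ℕ) : ‖triSign q n‖ = ‖q‖ ^ (n * (n + 1) / 2) := by
  simp [triSign]

lemma one_le_one_sub_norm_inv (hq : ‖q‖ < 1) : 1 ≤ (1 - ‖q‖)⁻¹ :=
  (one_le_inv₀ (by linarith)).mpr (by linarith [norm_nonneg q])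

lemma norm_qPochInv_mul_le (hq : ‖q‖ < 1) (N r : ℕ) :
    ‖qPochInv q (N - r - 1)‖ * ‖qPochInv q (N + r + 1)‖ ≤ (1 - ‖q‖)⁻¹ ^ (2 * N) := by
  have hD := one_le_one_sub_norm_inv hq
  rcases lt_or_ge r N with h | h
  · obtain ⟨m, rfl⟩ := Nat.exists_eq_add_of_lt h
    rw [show (((r + m + 1 : ℕ) : ℤ) - r - 1) = m by push_cast; ring,
      show (((r + m + 1 : ℕ) : ℤ) + r + 1) = (r + m + 1 + r + 1 : ℕ) by push_cast; ring]
    refine (mul_le_mul (norm_qPochInv_le hq _) (norm_qPochInv_le hq _) (norm_nonneg _)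
      (by positivity)).trans_eq ?_
    rw [← pow_add]
    congr 1
    ring
  · rw [qPochInv_of_neg (by lia), norm_zero, zero_mul]
    positivity

/-- The tail estimate for the conjugate Bailey pair. -/
lemma norm_sum_baileyKernel_sub_le (hq : ‖q‖ < 1) (q0 : q ≠ 0) (N r : ℕ) :
    ‖∑ n ∈ range N, baileyKernel q n r - triSign q r‖ ≤
      (2 * r + 1) * ((2 * (1 - ‖q‖)⁻¹ ^ 2) ^ N * ‖q‖ ^ (N * (N + 1) / 2)) := by
  have hD := one_le_one_sub_norm_inv hq
  induction r with
  | zero =>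
    have e : ((0 : ℕ) : ℤ) = 0 := rfl
    rw [e, sum_baileyKernel_zero hq,
      show 1 - triSign q N * qPochInv q N - triSign q 0 = -(triSign q N * qPochInv q N) by
        simp [triSign], norm_neg, norm_mul, norm_triSign, mul_comm, Nat.cast_zero, mul_zero,
      zero_add, one_mul]
    gcongr
    refine (norm_qPochInv_le hq N).trans ?_
    gcongr
    nlinarith
  | succ r ih =>
    have hr : ‖q ^ (r + 1)‖ ≤ 1 := by
      rw [norm_pow]
      exact pow_le_one₀ (norm_nonneg q) hq.le
    have hr' : ‖1 + q ^ (r + 1)‖ ≤ 2 := by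
      refine (norm_add_le _ _).trans ?_
      rw [norm_one]
      linarith
    have hG : ‖qPoch q N * triSign q N * qPochInv q (N - r - 1) * qPochInv q (N + r + 1)‖ ≤
        (2 * (1 - ‖q‖)⁻¹ ^ 2) ^ N * ‖q‖ ^ (N * (N + 1) / 2) := by
      rw [mul_assoc, norm_mul, norm_mul, norm_mul (qPochInv _ _), norm_triSign]
      calc _ ≤ (2 ^ N * ‖q‖ ^ (N * (N + 1) / 2)) * (1 - ‖q‖)⁻¹ ^ (2 * N) := by
            gcongr
            · exact norm_qPoch_le hq N
            · exact norm_qPochInv_mul_le hq N r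
        _ = _ := by ring
    rw [sum_baileyKernel_succ hq q0, triSign_succ]
    set S := ∑ n ∈ range N, baileyKernel q n r
    set G := qPoch q N * triSign q N * qPochInv q (N - r - 1) * qPochInv q (N + r + 1)
    set E := (2 * (1 - ‖q‖)⁻¹ ^ 2) ^ N * ‖q‖ ^ (N * (N + 1) / 2)
    calc _ = ‖-(q ^ (r + 1) * (S - triSign q r)) - (1 + q ^ (r + 1)) * G‖ := by
          congr 1
          ring
      _ ≤ ‖q ^ (r + 1)‖ * ‖S - triSign q r‖ + ‖1 + q ^ (r + 1)‖ * ‖G‖ := by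
          refine (norm_sub_le _ _).trans ?_
          rw [norm_neg, norm_mul, norm_mul]
      _ ≤ 1 * ((2 * r + 1) * E) + 2 * E := by gcongr
      _ = _ := by
          push_cast
          ring

lemma exists_mul_self_eq (i : ℕ) : ∃ t : ℕ, i * i = i + 2 * t := by
  induction i with
  | zero => exact ⟨0, rfl⟩
  | succ i ih =>
    obtain ⟨t, ht⟩ := ih
    exact ⟨t + i, by lia⟩

lemma baileyCoeff_natCast (q0 : q ≠ 0) {i t : ℕ} (ht : i * i = i + 2 * t) :
    baileyCoeff q i = q ^ (12 * t + 5 * i) - q ^ (12 * t + 11 * i + 1) := by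
  have ht' : (i : ℤ) * i = i + 2 * t := by exact_mod_cast ht
  rw [baileyCoeff, mul_sub, mul_one, ← zpow_add₀ q0, ← zpow_natCast, ← zpow_natCast]
  congr 2 <;> push_cast <;> linear_combination 6 * ht'

lemma baileyCoeff_neg (q0 : q ≠ 0) {i t : ℕ} (ht : i * i = i + 2 * t) :
    baileyCoeff q (-1 - i) = q ^ (12 * t + 19 * i + 7) - q ^ (12 * t + 13 * i + 2) := by
  have ht' : (i : ℤ) * i = i + 2 * t := by exact_mod_cast ht
  rw [baileyCoeff, mul_sub, mul_one, ← zpow_add₀ q0, ← zpow_natCast, ← zpow_natCast]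
  congr 2 <;> push_cast <;> linear_combination 6 * ht'

lemma norm_pow_sub_pow_le (hq : ‖q‖ < 1) (a b : ℕ) : ‖q ^ a - q ^ b‖ ≤ 2 := by
  refine (norm_sub_le _ _).trans ?_
  rw [norm_pow, norm_pow]
  linarith [pow_le_one₀ (norm_nonneg q) hq.le (n := a), pow_le_one₀ (norm_nonneg q) hq.le (n := b)]

end

lemma eps84_add_mul (i k : ℕ) : eps84 (42 * i + k) = (-1) ^ i * eps84 k := by
  induction i with
  | zero => simp
  | succ i ih =>
    have h : ∀ n, eps84 (42 + n) = -eps84 n := by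
      intro n
      simp only [eps84]
      split_ifs <;> first | rfl | (exfalso; lia)
    rw [show 42 * (i + 1) + k = 42 + (42 * i + k) by ring, h, ih]
    ring

section

variable {q : ℂ}

lemma sum_eps84_block (q0 : q ≠ 0) (i : ℕ) :
    ∑ x ∈ range 42, (eps84 (42 * i + x + 1) : ℂ) * q ^ (((42 * i + x + 1) ^ 2 - 1) / 168) =
      baileyCoeff q i * triSign q (3 * i) + baileyCoeff q (-1 - i) * triSign q (3 * i + 2) := by
  obtain ⟨t, ht⟩ := exists_mul_self_eq i
  have e1 : ((42 * i + 1) ^ 2 - 1) / 168 = 21 * t + 11 * i := by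
    have : (42 * i + 1) ^ 2 = 168 * (21 * t + 11 * i) + 1 := by linear_combination 1764 * ht
    lia
  have e2 : ((42 * i + 12 + 1) ^ 2 - 1) / 168 = 21 * t + 17 * i + 1 := by
    have : (42 * i + 12 + 1) ^ 2 = 168 * (21 * t + 17 * i + 1) + 1 := by
      linear_combination 1764 * ht
    lia
  have e3 : ((42 * i + 28 + 1) ^ 2 - 1) / 168 = 21 * t + 25 * i + 5 := by
    have : (42 * i + 28 + 1) ^ 2 = 168 * (21 * t + 25 * i + 5) + 1 := by
      linear_combination 1764 * ht
    lia
  have e4 : ((42 * i + 40 + 1) ^ 2 - 1) / 168 = 21 * t + 31 * i + 10 := by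
    have : (42 * i + 40 + 1) ^ 2 = 168 * (21 * t + 31 * i + 10) + 1 := by
      linear_combination 1764 * ht
    lia
  have s1 : 3 * i * (3 * i + 1) / 2 = 9 * t + 6 * i := by
    have : 3 * i * (3 * i + 1) = 2 * (9 * t + 6 * i) := by linear_combination 9 * ht
    lia
  have s2 : (3 * i + 2) * (3 * i + 2 + 1) / 2 = 9 * t + 12 * i + 3 := by
    have : (3 * i + 2) * (3 * i + 2 + 1) = 2 * (9 * t + 12 * i + 3) := by linear_combination 9 * ht
    lia
  have s3 : ((-1 : ℂ)) ^ (3 * i) = (-1) ^ i := by rw [pow_mul]; norm_num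
  have hsum : ∑ x ∈ range 42,
      (eps84 (42 * i + x + 1) : ℂ) * q ^ (((42 * i + x + 1) ^ 2 - 1) / 168) =
      ∑ x ∈ range 42, (-1) ^ i * ((eps84 (x + 1) : ℂ) * q ^ (((42 * i + x + 1) ^ 2 - 1) / 168)) := by
    refine sum_congr rfl fun x _ => ?_
    rw [add_assoc, eps84_add_mul]
    push_cast
    ring
  rw [hsum, ← mul_sum, baileyCoeff_natCast q0 ht, baileyCoeff_neg q0 ht, triSign, triSign, s1, s2,
    pow_add (-1 : ℂ), s3]
  simp only [sum_range_succ, eps84]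
  norm_num
  rw [e1, e2, e3, e4]
  ring

lemma sum_eps84_range (q0 : q ≠ 0) (N : ℕ) :
    ∑ n ∈ range (42 * N), (eps84 (n + 1) : ℂ) * q ^ (((n + 1) ^ 2 - 1) / 168) =
      ∑ i ∈ range N, (baileyCoeff q i * triSign q (3 * i) +
        baileyCoeff q (-1 - i) * triSign q (3 * i + 2)) := by
  induction N with
  | zero => simp
  | succ N ih => rw [mul_add, mul_one, sum_range_add, ih, sum_range_succ _ N, sum_eps84_block q0]

lemma hypergeometric_term_eq (hq : ‖q‖ < 1) (n : ℕ) :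
    (-1 : ℂ) ^ n * q ^ (n * (n + 1) / 2) / ∏ k ∈ range n, (1 - q ^ (n + k + 1)) =
      qPoch q n * triSign q n * qPochInv q (2 * n : ℕ) := by
  have h : qPoch q (2 * n) = qPoch q n * ∏ k ∈ range n, (1 - q ^ (n + k + 1)) := by
    rw [two_mul]
    exact prod_range_add _ _ _
  have h1 := qPoch_ne_zero hq (2 * n)
  rw [h] at h1
  have h2 := left_ne_zero_of_mul h1
  have h3 := right_ne_zero_of_mul h1
  rw [qPochInv_natCast, h, triSign]
  field_simp

lemma sum_hypergeometric_range (hq : ‖q‖ < 1) (q0 : q ≠ 0) (N : ℕ) :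
    ∑ n ∈ range N,
      (-1 : ℂ) ^ n * q ^ (n * (n + 1) / 2) / ∏ k ∈ range n, (1 - q ^ (n + k + 1)) =
      ∑ i ∈ range N, (baileyCoeff q i * ∑ n ∈ range N, baileyKernel q n (3 * i : ℕ) +
        baileyCoeff q (-1 - i) * ∑ n ∈ range N, baileyKernel q n (3 * i + 2 : ℕ)) := by
  simp only [mul_sum, ← sum_add_distrib]
  rw [sum_comm]
  refine sum_congr rfl fun n hn => ?_
  rw [hypergeometric_term_eq hq, ← sum_baileyPair hq q0 (mem_range.mp hn), mul_sum]
  refine sum_congr rfl fun i _ => ?_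
  rw [baileyKernel, baileyKernel,
    show ((n : ℤ) - 3 * (-1 - i)) = n + (3 * i + 2 : ℕ) + 1 by push_cast; ring,
    show ((n : ℤ) + 3 * (-1 - i) + 1) = n - (3 * i + 2 : ℕ) by push_cast; ring]
  push_cast
  ring

lemma norm_partial_sum_sub_le (hq : ‖q‖ < 1) (q0 : q ≠ 0) (N : ℕ) :
    ‖∑ n ∈ range N,
        (-1 : ℂ) ^ n * q ^ (n * (n + 1) / 2) / ∏ k ∈ range n, (1 - q ^ (n + k + 1)) -
      ∑ n ∈ range (42 * N), (eps84 (n + 1) : ℂ) * q ^ (((n + 1) ^ 2 - 1) / 168)‖ ≤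
      48 * ((8 * (1 - ‖q‖)⁻¹ ^ 2) ^ N * ‖q‖ ^ (N * (N + 1) / 2)) := by
  have hD := one_le_one_sub_norm_inv hq
  rw [sum_hypergeometric_range hq q0, sum_eps84_range q0, ← sum_sub_distrib]
  set E := (2 * (1 - ‖q‖)⁻¹ ^ 2) ^ N * ‖q‖ ^ (N * (N + 1) / 2) with hE
  have hE0 : 0 ≤ E := by positivity
  have hterm : ∀ i ∈ range N,
      ‖(baileyCoeff q i * ∑ n ∈ range N, baileyKernel q n (3 * i : ℕ) +
        baileyCoeff q (-1 - i) * ∑ n ∈ range N, baileyKernel q n (3 * i + 2 : ℕ)) -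
      (baileyCoeff q i * triSign q (3 * i) +
        baileyCoeff q (-1 - i) * triSign q (3 * i + 2))‖ ≤ 24 * N * E := by
    intro i hi
    have hi' : (i : ℝ) + 1 ≤ N := by exact_mod_cast mem_range.mp hi
    obtain ⟨t, ht⟩ := exists_mul_self_eq i
    have c1 : ‖baileyCoeff q i‖ ≤ 2 := by
      rw [baileyCoeff_natCast q0 ht]
      exact norm_pow_sub_pow_le hq _ _
    have c2 : ‖baileyCoeff q (-1 - i)‖ ≤ 2 := by
      rw [baileyCoeff_neg q0 ht]
      exact norm_pow_sub_pow_le hq _ _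
    have k1 := norm_sum_baileyKernel_sub_le hq q0 N (3 * i)
    have k2 := norm_sum_baileyKernel_sub_le hq q0 N (3 * i + 2)
    rw [← hE] at k1 k2
    rw [add_sub_add_comm, ← mul_sub, ← mul_sub]
    refine (norm_add_le _ _).trans ?_
    rw [norm_mul, norm_mul]
    calc _ ≤ 2 * ((2 * (3 * i : ℕ) + 1) * E) + 2 * ((2 * (3 * i + 2 : ℕ) + 1) * E) := by gcongr
      _ = (24 * i + 12) * E := by
          push_cast
          ring
      _ ≤ 24 * N * E := by
          gcongr
          linarith
  refine (norm_sum_le_of_le _ hterm).trans ?_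
  rw [sum_const, card_range, nsmul_eq_mul]
  have hN : (N : ℝ) * N ≤ 4 ^ N := by
    have h2 : (N : ℝ) ≤ 2 ^ N := by exact_mod_cast Nat.lt_two_pow_self.le
    calc (N : ℝ) * N ≤ 2 ^ N * 2 ^ N := by gcongr
      _ = 4 ^ N := by rw [← mul_pow]; norm_num
  calc (N : ℝ) * (24 * N * E) = 24 * ((N * N) * E) := by ring
    _ ≤ 48 * (4 ^ N * E) := by gcongr; norm_num
    _ = _ := by
        rw [hE, ← mul_assoc (4 ^ N : ℝ), ← mul_pow]
        ring_nf

end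

lemma summable_pow_mul_pow_triangle {ρ : ℝ} (h0 : 0 ≤ ρ) (h1 : ρ < 1) {L : ℝ} (hL : 0 < L) :
    Summable fun n : ℕ => L ^ n * ρ ^ (n * (n + 1) / 2) := by
  rcases h0.eq_or_lt with rfl | h0
  · refine summable_of_ne_finset_zero (s := {0}) fun n hn => ?_
    have hn' : 1 ≤ n := Nat.one_le_iff_ne_zero.mpr (by simpa using hn)
    have : n * (n + 1) / 2 ≠ 0 := by
      have : 1 * 2 ≤ n * (n + 1) := by gcongr; lia
      lia
    simp [this]
  · refine summable_of_ratio_test_tendsto_lt_one zero_lt_one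
      (Eventually.of_forall fun n => by positivity) ?_
    have hlim : Tendsto (fun n : ℕ => L * (ρ ^ n * ρ)) atTop (𝓝 0) := by
      simpa using ((tendsto_pow_atTop_nhds_zero_of_lt_one h0.le h1).mul_const ρ).const_mul L
    refine hlim.congr fun n => ?_
    have h : (n + 1) * (n + 1 + 1) / 2 = n * (n + 1) / 2 + (n + 1) := by
      rw [← Nat.add_mul_div_right _ _ two_pos]
      congr 1
      ring
    rw [h, Real.norm_of_nonneg (by positivity), Real.norm_of_nonneg (by positivity),
      eq_div_iff (by positivity)]
    ring

lemma norm_eps84_le (n : ℕ) : ‖(eps84 n : ℂ)‖ ≤ 1 := by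
  simp only [eps84]
  split_ifs <;> simp

lemma summable_norm_eps84_series {q : ℂ} (hq : ‖q‖ < 1) :
    Summable fun n : ℕ => ‖(eps84 (n + 1) : ℂ) * q ^ (((n + 1) ^ 2 - 1) / 168)‖ := by
  refine Summable.of_norm_bounded_eventually_nat
    (summable_geometric_of_lt_one (norm_nonneg q) hq) ?_
  filter_upwards [eventually_ge_atTop 168] with n hn
  rw [norm_norm, norm_mul, norm_pow]
  have h : n ≤ ((n + 1) ^ 2 - 1) / 168 := by
    rw [Nat.le_div_iff_mul_le (by norm_num)]
    refine Nat.le_sub_of_add_le ?_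
    nlinarith
  calc _ ≤ 1 * ‖q‖ ^ n := by
        refine mul_le_mul (norm_eps84_le _) ?_ (by positivity) zero_le_one
        exact pow_le_pow_of_le_one (norm_nonneg q) hq.le h
    _ = _ := one_mul _

lemma summable_norm_hypergeometric_series {q : ℂ} (hq : ‖q‖ < 1) :
    Summable fun n : ℕ => ‖(-1 : ℂ) ^ n * q ^ (n * (n + 1) / 2) /
      ∏ k ∈ range n, (1 - q ^ (n + k + 1))‖ := by
  have hD := one_le_one_sub_norm_inv hq
  refine Summable.of_nonneg_of_le (fun _ => norm_nonneg _) (fun n => ?_)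
    (summable_pow_mul_pow_triangle (norm_nonneg q) hq (L := (1 - ‖q‖)⁻¹) (by positivity))
  rw [div_eq_mul_inv, norm_mul, mul_comm, ← prod_inv_distrib]
  refine mul_le_mul ?_ (by simp) (norm_nonneg _) (by positivity)
  exact norm_prod_range_le_pow (fun k => norm_one_sub_pow_inv_le hq (n + k)) n

/-- the false theta function `q^{−1/168}Ψ^{42+6,14,21}_1`
(the homological block of the Brieskorn sphere `Σ(2,3,7)`) as a
`q`-hypergeometric series:
`Σ_{n≥1} ε₈₄(n) q^{(n²−1)/168} = Σ_{n≥0} (−1)ⁿ q^{n(n+1)/2}/(q^{n+1};q)_n`. -/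
theorem falseTheta_Sigma237_qHypergeometric (q : ℂ) (hq : ‖q‖ < 1) :
    (Summable fun n : ℕ =>
      ‖(eps84 (n + 1) : ℂ) * q ^ (((n + 1) ^ 2 - 1) / 168)‖) ∧
    (Summable fun n : ℕ =>
      ‖(-1 : ℂ) ^ n * q ^ (n * (n + 1) / 2) /
        ∏ k ∈ Finset.range n, (1 - q ^ (n + k + 1))‖) ∧
    ∑' n : ℕ, (eps84 (n + 1) : ℂ) * q ^ (((n + 1) ^ 2 - 1) / 168) =
      ∑' n : ℕ, (-1 : ℂ) ^ n * q ^ (n * (n + 1) / 2) /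
        ∏ k ∈ Finset.range n, (1 - q ^ (n + k + 1)) := by
  refine ⟨summable_norm_eps84_series hq, summable_norm_hypergeometric_series hq, ?_⟩
  rcases eq_or_ne q 0 with rfl | q0
  · rw [tsum_eq_single 0, tsum_eq_single 0]
    · simp [eps84]
    · intro n hn
      have : n * (n + 1) / 2 ≠ 0 := by
        have : 1 * 2 ≤ n * (n + 1) := Nat.mul_le_mul (by lia) (by lia)
        lia
      simp [this]
    · intro n hn
      rcases lt_or_ge n 12 with h | h
      · interval_cases n <;> simp [eps84] at hn ⊢
      · have : ((n + 1) ^ 2 - 1) / 168 ≠ 0 := by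
          have : 13 ^ 2 ≤ (n + 1) ^ 2 := Nat.pow_le_pow_left (by lia) 2
          lia
        simp [this]
  · have hD := one_le_one_sub_norm_inv hq
    have hL := ((summable_norm_eps84_series hq).of_norm.hasSum.tendsto_sum_nat).comp
      (tendsto_id.const_mul_atTop' (by norm_num : 0 < 42))
    have hR := (summable_norm_hypergeometric_series hq).of_norm.hasSum.tendsto_sum_nat
    have hE := ((summable_pow_mul_pow_triangle (norm_nonneg q) hq
      (L := 8 * (1 - ‖q‖)⁻¹ ^ 2) (by positivity)).tendsto_atTop_zero.const_mul 48)
    rw [mul_zero] at hE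
    have h0 := squeeze_zero_norm (norm_partial_sum_sub_le hq q0) hE
    exact (sub_eq_zero.mp (tendsto_nhds_unique (hR.sub hL) h0)).symm
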